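/- arXiv:1602.00559 — 3 statements merged into one kernel-verified Lean document; each statement's English description precedes it below -/
import Mathlib

section
/- Let n_x, n_f ≥ 1 and consider the LPV state-space model with matrices A, C, coefficient vectors L_r, B_r and basis functions f_r. Let p : ℕ → ℙ, u : ℕ → ℝ, and let x : ℕ → ℝ^{n_x} satisfy x_0 = 0, x_{k+1} = (A + L(p_k)C) x_k + B(p_k) u_k, and set y_k = C x_k. Define φ : ℕ → ℝ^{2 n_x n_f} by φ_0 = 0 and φ_{k+1} = 𝒜 φ_k + ℬ ((y_k, u_k)ᵀ ⊗ F(p_k)). Then for every k ∈ ℕ, y_k = θᵀ φ_k. -/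
open Matrix

/-- A linear system with input matrix columns `θ q` and output row `C`, started at zero, has the
same output as the bank of transposed filters driven through `C` and read out by `θ q`. -/
theorem dotProduct_state_eq_sum_dotProduct_filter {R ι n : Type*} [CommRing R] [Fintype ι]
    [Fintype n] [DecidableEq n] (A : Matrix n n R) (C : n → R) (θ : ι → n → R) (w : ℕ → ι → R)
    (x : ℕ → n → R) (φ : ℕ → ι → n → R) (hx0 : x 0 = 0) (hφ0 : φ 0 = 0)
    (hx : ∀ k, x (k + 1) = A *ᵥ x k + ∑ q, w k q • θ q)
    (hφ : ∀ k q, φ (k + 1) q = Aᵀ *ᵥ φ k q + w k q • C) (k m : ℕ) :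
    C ⬝ᵥ (A ^ m *ᵥ x k) = ∑ q, (A ^ m *ᵥ θ q) ⬝ᵥ φ k q := by
  induction k generalizing m with
  | zero => simp [hx0, hφ0]
  | succ k ih =>
    have hfilter (q : ι) : (A ^ m *ᵥ θ q) ⬝ᵥ (Aᵀ *ᵥ φ k q) = (A ^ (m + 1) *ᵥ θ q) ⬝ᵥ φ k q := by
      rw [dotProduct_mulVec, vecMul_transpose, mulVec_mulVec, ← pow_succ']
    simp only [hx, hφ, mulVec_add, dotProduct_add, mulVec_mulVec, ← pow_succ, ih, hfilter,
      Finset.sum_add_distrib, mulVec_sum, dotProduct_sum, mulVec_smul, dotProduct_smul]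
    simp only [dotProduct_comm C]

/-- Proposition 1, zero initial conditions, `ℕ` time axis:
for the LPV model `x_{k+1} = (A + L(p_k)C) x_k + B(p_k) u_k`, `y_k = C x_k` with
`L(p) = ∑_r L_r f_r(p)`, `B(p) = ∑_r B_r f_r(p)`, `x_0 = 0`, the predictor state
`φ_0 = 0`, `φ_{k+1} = 𝒜 φ_k + ℬ ((y_k, u_k)ᵀ ⊗ F(p_k))` with
`𝒜 = I_{2n_f} ⊗ Aᵀ = blkdiag{Aᵀ, …, Aᵀ}` and `ℬ = I_{2n_f} ⊗ Cᵀ = blkdiag{Cᵀ, …, Cᵀ}`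
satisfies `y_k = θᵀ φ_k` for every `k`, where `θ = [vec(𝐋); vec(𝐁)]`.
Indices: the `2 n_x n_f` coordinates are indexed by `((s, r), i)` with `s : Fin 2`
(the `y`/`u` block), `r : Fin n_f` (the basis function / column of `vec`) and
`i : Fin n_x`; the `2 n_f` coordinates of `(y_k, u_k)ᵀ ⊗ F(p_k)` by `(s, r)`. -/
theorem lpv_predictor_linear_in_theta
    (nx nf : ℕ) (hnx : 1 ≤ nx) (hnf : 1 ≤ nf)
    (P : Type*) (f : Fin nf → P → ℝ)
    (L B : Fin nf → Fin nx → ℝ)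
    (A : Matrix (Fin nx) (Fin nx) ℝ) (C : Fin nx → ℝ)
    (p : ℕ → P) (u : ℕ → ℝ) (x : ℕ → Fin nx → ℝ) (y : ℕ → ℝ)
    (hx0 : x 0 = 0)
    (hx : ∀ k : ℕ, x (k + 1) =
      (A + Matrix.of fun i j => (∑ r, f r (p k) • L r) i * C j).mulVec (x k)
        + u k • (∑ r, f r (p k) • B r))
    (hy : ∀ k : ℕ, y k = C ⬝ᵥ x k)
    (θ : (Fin 2 × Fin nf) × Fin nx → ℝ)
    (hθ : ∀ (s : Fin 2) (r : Fin nf) (i : Fin nx),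
      θ ((s, r), i) = if s = 0 then L r i else B r i)
    (𝒜 : Matrix ((Fin 2 × Fin nf) × Fin nx) ((Fin 2 × Fin nf) × Fin nx) ℝ)
    (h𝒜 : ∀ qi qj : (Fin 2 × Fin nf) × Fin nx,
      𝒜 qi qj = if qi.1 = qj.1 then Aᵀ qi.2 qj.2 else 0)
    (ℬ : Matrix ((Fin 2 × Fin nf) × Fin nx) (Fin 2 × Fin nf) ℝ)
    (hℬ : ∀ (qi : (Fin 2 × Fin nf) × Fin nx) (q' : Fin 2 × Fin nf),
      ℬ qi q' = if qi.1 = q' then C qi.2 else 0)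
    (φ : ℕ → (Fin 2 × Fin nf) × Fin nx → ℝ)
    (hφ0 : φ 0 = 0)
    (hφ : ∀ k : ℕ, φ (k + 1) =
      𝒜.mulVec (φ k) + ℬ.mulVec (fun q => ![y k, u k] q.1 * f q.2 (p k))) :
    ∀ k : ℕ, y k = θ ⬝ᵥ φ k := by
  intro k
  have key := dotProduct_state_eq_sum_dotProduct_filter A C (fun q i => θ (q, i))
    (fun k q => ![y k, u k] q.1 * f q.2 (p k)) x (fun k q i => φ k (q, i)) hx0
    (by funext q i; simp [hφ0]) ?_ ?_ k 0
  · rw [hy]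
    simpa [dotProduct, Fintype.sum_prod_type] using key
  · intro k
    have houter : (Matrix.of fun i j => (∑ r, f r (p k) • L r) i * C j) *ᵥ x k =
        y k • ∑ r, f r (p k) • L r := by
      funext i
      simp only [hy, mulVec, dotProduct, of_apply, Pi.smul_apply, smul_eq_mul]
      rw [mul_comm, Finset.mul_sum]
      simp only [mul_assoc]
    rw [hx, add_mulVec, houter, add_assoc]
    congr 1
    funext i
    simp [Fintype.sum_prod_type, hθ, Finset.mul_sum, mul_assoc]
  · intro k q
    funext i
    simp [hφ, mulVec, dotProduct, h𝒜, hℬ, Fintype.sum_prod_type, mul_comm]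
end

section
/- Let n_x, n_f ≥ 1 and consider the LPV state-space model with coefficient vectors L_r, B_r and basis functions f_r, where A is the companion matrix with A_{i+1,i} = 1 for i = 1..n_x−1 and all other entries zero (i.e. all α_m = 0, so α(q) = q^{n_x}), and C = (0, …, 0, 1). Let p : ℕ → ℙ, u : ℕ → ℝ, let x : ℕ → ℝ^{n_x} be any solution of x_{k+1} = (A + L(p_k)C) x_k + B(p_k) u_k with arbitrary initial state x_0, and set y_k = C x_k. Then for every k ≥ n_x: y_k = Σ_{m=1}^{n_x} ( (L(p_{k−m}))_{n_x+1−m} · y_{k−m} + (B(p_{k−m}))_{n_x+1−m} · u_{k−m} ), where (v)_j denotes the j-th component of v ∈ ℝ^{n_x}. -/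
open Matrix

/-- Unrolling a shift register driven by `g`: after `i + 1` steps the `i`-th cell no longer
depends on the initial state. -/
theorem shift_register_eq_sum {M : Type*} [AddCommMonoid M] {n : ℕ} (x g : ℕ → Fin n → M)
    (h0 : ∀ k (h : 0 < n), x (k + 1) ⟨0, h⟩ = g k ⟨0, h⟩)
    (hs : ∀ k i (h : i + 1 < n),
      x (k + 1) ⟨i + 1, h⟩ = x k ⟨i, by omega⟩ + g k ⟨i + 1, h⟩)
    (i : ℕ) (hi : i < n) (k : ℕ) (hk : i + 1 ≤ k) :
    x k ⟨i, hi⟩ = ∑ m : Fin (i + 1), g (k - ((m : ℕ) + 1)) ⟨i - m, by omega⟩ := by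
  induction i generalizing k with
  | zero =>
    obtain ⟨k, rfl⟩ := Nat.exists_eq_add_of_le' hk
    simpa using h0 k hi
  | succ i ih =>
    obtain ⟨k, rfl⟩ := Nat.exists_eq_add_of_le' (show 1 ≤ k by omega)
    rw [hs, ih (by omega) k (by omega), Fin.sum_univ_succ (n := i + 1), add_comm]
    have hg : ∀ {a b : ℕ} {c d : Fin n}, a = b → c = d → g a c = g b d := by
      rintro _ _ _ _ rfl rfl
      rfl
    refine congrArg₂ (· + ·) rfl (Finset.sum_congr rfl fun m _ => hg ?_ (Fin.ext ?_)) <;>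
      simp only [Fin.val_succ] <;> omega

theorem shift_mulVec_zero {R : Type*} [NonAssocSemiring R] {n : ℕ}
    {A : Matrix (Fin n) (Fin n) R}
    (hA : ∀ i j : Fin n, A i j = if (i : ℕ) = (j : ℕ) + 1 then 1 else 0)
    (v : Fin n → R) (h : 0 < n) : (A *ᵥ v) ⟨0, h⟩ = 0 := by
  simp [mulVec, dotProduct, hA]

theorem shift_mulVec_succ {R : Type*} [NonAssocSemiring R] {n : ℕ}
    {A : Matrix (Fin n) (Fin n) R}
    (hA : ∀ i j : Fin n, A i j = if (i : ℕ) = (j : ℕ) + 1 then 1 else 0)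
    (v : Fin n → R) (i : ℕ) (h : i + 1 < n) :
    (A *ᵥ v) ⟨i + 1, h⟩ = v ⟨i, by omega⟩ := by
  rw [mulVec, dotProduct, Finset.sum_eq_single ⟨i, by omega⟩]
  · simp [hA]
  · intro j _ hj
    have : i ≠ j := fun e => hj (Fin.ext e.symm)
    simp [hA, this]
  · simp

/-- for the shift companion matrix (all `α_m = 0`, i.e. `α(q) = q^{n_x}`)
and `C = (0, …, 0, 1)`, any solution of the LPV state equation
`x_{k+1} = (A + L(p_k)C) x_k + B(p_k) u_k`, `y_k = C x_k`, with arbitrary initial state,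
satisfies for `k ≥ n_x` the LPV-ARX input–output relation
`y_k = ∑_{m=1}^{n_x} ((L(p_{k−m}))_{n_x+1−m} y_{k−m} + (B(p_{k−m}))_{n_x+1−m} u_{k−m})`.
Here `m : Fin n_x` stands for the 1-based lag `m+1`, and the 1-based component
`n_x+1−(m+1) = n_x−m` is the 0-based component `n_x−1−m.val = m.rev`. -/
theorem shifted_form_is_lpv_arx
    (nx nf : ℕ) (hnx : 1 ≤ nx) (hnf : 1 ≤ nf)
    (P : Type*) (f : Fin nf → P → ℝ)
    (L B : Fin nf → Fin nx → ℝ)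
    (A : Matrix (Fin nx) (Fin nx) ℝ)
    (hA : ∀ i j : Fin nx, A i j = if (i : ℕ) = (j : ℕ) + 1 then 1 else 0)
    (C : Fin nx → ℝ) (hC : ∀ i : Fin nx, C i = if (i : ℕ) = nx - 1 then 1 else 0)
    (p : ℕ → P) (u : ℕ → ℝ) (x : ℕ → Fin nx → ℝ) (y : ℕ → ℝ)
    (hx : ∀ k : ℕ, x (k + 1) =
      (A + Matrix.of fun i j => (∑ r, f r (p k) • L r) i * C j).mulVec (x k)
        + u k • (∑ r, f r (p k) • B r))
    (hy : ∀ k : ℕ, y k = C ⬝ᵥ x k) :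
    ∀ k : ℕ, nx ≤ k →
      y k = ∑ m : Fin nx,
        ((∑ r, f r (p (k - ((m : ℕ) + 1))) • L r) m.rev * y (k - ((m : ℕ) + 1))
          + (∑ r, f r (p (k - ((m : ℕ) + 1))) • B r) m.rev * u (k - ((m : ℕ) + 1))) := by
  obtain ⟨n, rfl⟩ := Nat.exists_eq_add_of_le' hnx
  have hstep : ∀ k i, x (k + 1) i = (A *ᵥ x k) i
      + ((∑ r, f r (p k) • L r) i * y k + (∑ r, f r (p k) • B r) i * u k) := by
    intro k i
    have hout : ((Matrix.of fun i j => (∑ r, f r (p k) • L r) i * C j) *ᵥ x k) i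
        = (∑ r, f r (p k) • L r) i * y k := by
      simp only [hy, mulVec, dotProduct, of_apply, Finset.mul_sum, mul_assoc]
    rw [hx, add_mulVec, Pi.add_apply, Pi.add_apply, hout, Pi.smul_apply, smul_eq_mul]
    ring
  intro k hk
  have hyk : y k = x k ⟨n, Nat.lt_succ_self n⟩ := by
    rw [hy, dotProduct, Finset.sum_eq_single ⟨n, Nat.lt_succ_self n⟩]
    · simp [hC]
    · intro j _ hj
      have : (j : ℕ) ≠ n := fun e => hj (Fin.ext e)
      simp [hC, this]
    · simp
  rw [hyk, shift_register_eq_sum x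
    (fun k i => (∑ r, f r (p k) • L r) i * y k + (∑ r, f r (p k) • B r) i * u k)
    (fun k h => by rw [hstep, shift_mulVec_zero hA, zero_add])
    (fun k i h => by rw [hstep, shift_mulVec_succ hA]) n (Nat.lt_succ_self n) k hk]
  refine Finset.sum_congr rfl fun m _ => ?_
  have hm : m.rev = ⟨n - m, by omega⟩ := by
    ext
    simp only [Fin.val_rev]
    omega
  rw [hm]
end

section
/- Let A ∈ ℝ^{n×n} and let C ∈ ℝ^{1×n} be a row vector such that the pair (C, A) is observable, i.e. the n×n matrix with rows C, CA, …, CA^{n−1} is invertible. Then for every monic real polynomial d of degree n there exists a column vector L ∈ ℝ^n such that the characteristic polynomial of A + L·C equals d. -/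
open Matrix Polynomial

theorem Matrix.aeval_mulVec_eq_sum {R : Type*} [CommRing R] {n : ℕ} (p : R[X]) {k : ℕ}
    (hp : p.natDegree < k) (M : Matrix (Fin n) (Fin n) R) (v : Fin n → R) :
    aeval M p *ᵥ v = ∑ i ∈ Finset.range k, p.coeff i • (M ^ i *ᵥ v) := by
  rw [aeval_eq_sum_range' hp, Matrix.sum_mulVec]
  simp only [Matrix.smul_mulVec]

/-- A rank one update `A + L C` has the same first powers on a vector `v` as `A`, as long as
`C` annihilates the earlier iterates of `v`. -/
theorem Matrix.add_vecMulVec_pow_mulVec {R : Type*} [CommRing R] {n : ℕ}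
    (A : Matrix (Fin n) (Fin n) R) (C L v : Fin n → R) (k : ℕ)
    (h : ∀ i < k, C ⬝ᵥ (A ^ i *ᵥ v) = 0) :
    (A + vecMulVec L C) ^ k *ᵥ v = A ^ k *ᵥ v := by
  induction k with
  | zero => simp
  | succ k ih =>
    rw [pow_succ', ← mulVec_mulVec, ih fun i hi => h i (by omega), add_mulVec, vecMulVec_mulVec,
      h k (by omega), pow_succ', ← mulVec_mulVec]
    simp

/-- If `C A ^ i v` vanishes for `i + 1 < n` and is `1` for `i + 1 = n`, then no nonzero polynomial
of degree less than `n` in `A` annihilates `v`. -/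
theorem Matrix.eq_zero_of_aeval_mulVec_eq_zero {R : Type*} [CommRing R] {n : ℕ}
    (A : Matrix (Fin n) (Fin n) R) (C v : Fin n → R)
    (h : ∀ i < n, C ⬝ᵥ (A ^ i *ᵥ v) = if i + 1 = n then 1 else 0)
    (p : R[X]) (hp : p.degree < n) (hpv : aeval A p *ᵥ v = 0) : p = 0 := by
  by_contra hp0
  have hd : p.natDegree < n := (natDegree_lt_iff_degree_lt hp0).2 hp
  have key : C ⬝ᵥ (A ^ (n - 1 - p.natDegree) *ᵥ (aeval A p *ᵥ v)) = p.leadingCoeff := by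
    rw [Matrix.aeval_mulVec_eq_sum p (Nat.lt_succ_self _), Matrix.mulVec_sum, dotProduct_sum,
      Finset.sum_eq_single p.natDegree]
    · rw [mulVec_smul, mulVec_mulVec, ← pow_add, dotProduct_smul, h _ (by omega),
        if_pos (by omega)]
      simp
    · intro i hi hne
      have hi' := Finset.mem_range.1 hi
      rw [mulVec_smul, mulVec_mulVec, ← pow_add, dotProduct_smul, h _ (by omega),
        if_neg (by omega), smul_zero]
    · simp
  rw [hpv, mulVec_zero, dotProduct_zero] at key
  exact hp0 (leadingCoeff_eq_zero.1 key.symm)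

/-- pole placement by output injection: if the pair `(C, A)` is observable,
i.e. the matrix with rows `C, CA, …, CA^{n−1}` is invertible, then for every monic real
polynomial `d` of degree `n` there is a column vector `L` such that the characteristic
polynomial of `A + L·C` equals `d`. -/
theorem pole_placement_by_output_injection
    (n : ℕ) (A : Matrix (Fin n) (Fin n) ℝ) (C : Fin n → ℝ)
    (hobs : IsUnit (Matrix.of fun i j : Fin n => (C ᵥ* (A ^ (i : ℕ))) j)) :
    ∀ d : Polynomial ℝ, d.Monic → d.natDegree = n →
      ∃ L : Fin n → ℝ,
        (A + Matrix.of fun i j : Fin n => L i * C j).charpoly = d := by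
  intro d hd hdn
  obtain ⟨v, hv⟩ := mulVec_surjective_iff_isUnit.2 hobs
    fun i : Fin n => if (i : ℕ) + 1 = n then 1 else 0
  have hCv : ∀ i < n, C ⬝ᵥ (A ^ i *ᵥ v) = if i + 1 = n then 1 else 0 := by
    intro i hi
    rw [dotProduct_mulVec]
    exact congrFun hv ⟨i, hi⟩
  refine ⟨-(aeval A d *ᵥ v), ?_⟩
  set L := -(aeval A d *ᵥ v) with hL
  change (A + vecMulVec L C).charpoly = d
  set M := A + vecMulVec L C with hM
  have hpow : ∀ i < n, M ^ i *ᵥ v = A ^ i *ᵥ v := fun i hi =>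
    add_vecMulVec_pow_mulVec A C L v i fun j hj => by
      rw [hCv j (by omega), if_neg (by omega)]
  have hMd : aeval M d *ᵥ v = 0 := by
    rcases Nat.eq_zero_or_pos n with rfl | hn
    · exact Subsingleton.elim _ _
    obtain ⟨m, rfl⟩ : ∃ m, n = m + 1 := ⟨n - 1, by omega⟩
    have htop : M ^ (m + 1) *ᵥ v = A ^ (m + 1) *ᵥ v + L := by
      rw [pow_succ', ← mulVec_mulVec, hpow m (by omega), hM, add_mulVec, vecMulVec_mulVec,
        hCv m (by omega), if_pos rfl, mulVec_mulVec, ← pow_succ']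
      simp
    have hlead : d.coeff (m + 1) = 1 := hdn ▸ hd.coeff_natDegree
    have hA := aeval_mulVec_eq_sum d (k := m + 2) (by omega) A v
    rw [Finset.sum_range_succ, hlead, one_smul] at hA
    rw [aeval_mulVec_eq_sum d (k := m + 2) (by omega), Finset.sum_range_succ, htop,
      Finset.sum_congr rfl fun i hi => by rw [hpow i (Finset.mem_range.1 hi)], smul_add, hlead,
      one_smul, one_smul, hL, hA]
    abel
  have hdeg : (M.charpoly - d).degree < n := by
    have hMdeg : M.charpoly.degree = n := by simp
    rw [← hMdeg]
    refine degree_sub_lt_left ?_ M.charpoly_monic.ne_zero ?_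
    · rw [hMdeg, degree_eq_natDegree hd.ne_zero, hdn]
    · rw [M.charpoly_monic.leadingCoeff, hd.leadingCoeff]
  have hMp : aeval M (M.charpoly - d) *ᵥ v = 0 := by
    rw [map_sub, aeval_self_charpoly, sub_mulVec, hMd, zero_mulVec, sub_zero]
  refine sub_eq_zero.1 (eq_zero_of_aeval_mulVec_eq_zero M C v (fun i hi => ?_) _ hdeg hMp)
  rw [hpow i hi, hCv i hi]
end
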